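/- (Monotonicity of the weighted energy Φ.) Let Q : ℝ³ × [0,∞) → 𝒬₀ be a classical solution of the relaxed Q-tensor flow satisfying the constancy-outside-a-compact-set condition, with initial data taking values in 𝒩. Fix z₀ = (x₀, t₀) with x₀ ∈ ℝ³ and t₀ > 0, and for 0 < R < √t₀ define Φ(R) = (R²/Γ) ∫_{ℝ³} [ (L₁/2)|∇Q(x, t₀ − R²)|² + f̃_B(Q(x, t₀ − R²))/ε ] G_{z₀}(x, t₀ − R²) dx. Then R ↦ Φ(R) is non-decreasing on the interval (0, √t₀/2). -/

import Mathlib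

open Matrix Finset MeasureTheory

noncomputable section

abbrev Mat := Matrix (Fin 3) (Fin 3) ℝ
abbrev Vec3 := Fin 3 → ℝ

/-- Spatial partial derivative `∂_k f`. -/
def pd (k : Fin 3) (f : Vec3 → ℝ) : Vec3 → ℝ := fun x => fderiv ℝ f x (Pi.single k 1)

/-- Spatial Laplacian `Δf = Σ_k ∂_k ∂_k f`. -/
def lap (f : Vec3 → ℝ) (x : Vec3) : ℝ := ∑ k : Fin 3, pd k (pd k f) x

/-- `|∇Q|²(x,t) = Σ_{k,i,j} (∂_k Q_{ij})²`. -/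
def gradSq (Q : Vec3 → ℝ → Mat) (x : Vec3) (t : ℝ) : ℝ :=
  ∑ k : Fin 3, ∑ i : Fin 3, ∑ j : Fin 3, pd k (fun y => Q y t i j) x ^ 2

def frob (A B : Mat) : ℝ := ∑ i : Fin 3, ∑ j : Fin 3, A i j * B i j
def mnormSq (A : Mat) : ℝ := frob A A
def sPlus (a b c : ℝ) : ℝ := (b + Real.sqrt (b ^ 2 + 24 * a * c)) / (4 * c)
def Jmap (a b c : ℝ) (Q : Mat) : Mat :=
  (a - c * mnormSq Q) • Q + b • (Q * Q) - (b / 3 * mnormSq Q) • (1 : Mat)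
def fB (a b c : ℝ) (Q : Mat) : ℝ :=
  -(a / 2) * mnormSq Q - b / 3 * (Q * Q * Q).trace + c / 4 * mnormSq Q ^ 2
def ftB (a b c : ℝ) (Q : Mat) : ℝ :=
  fB a b c Q + a * sPlus a b c ^ 2 / 3 + 2 * b * sPlus a b c ^ 3 / 27 - c * sPlus a b c ^ 4 / 9
def NSet (a b c : ℝ) : Set Mat :=
  {Q | ∃ n : Vec3, n ⬝ᵥ n = 1 ∧ Q = sPlus a b c • (vecMulVec n n - (1 / 3 : ℝ) • (1 : Mat))}

/-- `Q` is a classical solution of the relaxed Q-tensor flow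
`∂ₜQ = (1/(εΓ)) J(Q) + (L₁/Γ) ΔQ` for times `t ∈ I`. -/
def IsSolution (a b c Γ L1 ε : ℝ) (Q : Vec3 → ℝ → Mat) (I : Set ℝ) : Prop :=
  (∀ i j : Fin 3, ContDiff ℝ (⊤ : ℕ∞) fun p : Vec3 × ℝ => Q p.1 p.2 i j) ∧
    ∀ (x : Vec3), ∀ t ∈ I, ∀ i j : Fin 3,
      deriv (fun s => Q x s i j) t =
        1 / (ε * Γ) * Jmap a b c (Q x t) i j + L1 / Γ * lap (fun y => Q y t i j) x

/-- Constancy outside a compact set: `Q(x,t) = A ∈ 𝒩` for `x` outside a compact set `K`. -/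
def ConstOutside (a b c : ℝ) (Q : Vec3 → ℝ → Mat) (I : Set ℝ) : Prop :=
  ∃ A ∈ NSet a b c, ∃ K : Set Vec3, IsCompact K ∧ ∀ x ∉ K, ∀ t ∈ I, Q x t = A

/-- The energy density `e_ε(Q,∇Q) = f̃_B(Q)/(εΓ) + (L₁/(2Γ))|∇Q|²`. -/
def eDens (a b c Γ L1 ε : ℝ) (Q : Vec3 → ℝ → Mat) (x : Vec3) (t : ℝ) : ℝ :=
  ftB a b c (Q x t) / (ε * Γ) + L1 / (2 * Γ) * gradSq Q x t

/-- The scaled backward heat kernel `G_{z₀}(x,t)`. -/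
def Gk (Γ L1 : ℝ) (x₀ : Vec3) (t₀ : ℝ) (x : Vec3) (t : ℝ) : ℝ :=
  (4 * Real.pi * (L1 / Γ) * (t₀ - t)) ^ (-(3 : ℝ) / 2) *
    Real.exp (-(∑ i : Fin 3, (x i - x₀ i) ^ 2) / (4 * (L1 / Γ) * (t₀ - t)))

open Topology

/-- The traces of the powers of a real symmetric matrix in terms of its eigenvalues. -/
theorem trace_pow_eq_sum_eigenvalues {n : Type*} [Fintype n] [DecidableEq n]
    {A : Matrix n n ℝ} (hA : A.IsHermitian) (k : ℕ) :
    (A ^ k).trace = ∑ i, hA.eigenvalues i ^ k := by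
  conv_lhs => rw [hA.spectral_theorem, ← map_pow, Matrix.diagonal_pow]
  rw [Unitary.conjStarAlgAut_apply, Matrix.trace_mul_cycle, Unitary.coe_star_mul_self,
    one_mul, Matrix.trace_diagonal]
  simp

theorem mnormSq_eq_trace {A : Mat} (hA : Aᵀ = A) : mnormSq A = (A ^ 2).trace := by
  have h : ∀ i j, A j i = A i j := fun i j => congrFun (congrFun hA i) j
  simp only [mnormSq, frob, pow_two, Matrix.trace, Matrix.diag, Matrix.mul_apply, h]

theorem trace_cube_sq_le {A : Mat} (hA : Aᵀ = A) (htr : A.trace = 0) :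
    6 * (A ^ 3).trace ^ 2 ≤ mnormSq A ^ 3 := by
  have hH : A.IsHermitian := by
    rw [Matrix.IsHermitian, Matrix.conjTranspose_eq_transpose_of_trivial, hA]
  have h1 := trace_pow_eq_sum_eigenvalues hH 1
  have h2 := trace_pow_eq_sum_eigenvalues hH 2
  have h3 := trace_pow_eq_sum_eigenvalues hH 3
  rw [mnormSq_eq_trace hA, h2, h3]
  rw [pow_one, htr] at h1
  simp only [Fin.sum_univ_three, pow_one] at h1 ⊢
  generalize hH.eigenvalues 0 = x at *
  generalize hH.eigenvalues 1 = y at *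
  generalize hH.eigenvalues 2 = z at *
  obtain rfl : z = -x - y := by linarith
  have key : (x ^ 2 + y ^ 2 + (-x - y) ^ 2) ^ 3 - 6 * (x ^ 3 + y ^ 3 + (-x - y) ^ 3) ^ 2
      = 2 * ((x - y) * (2 * x + y) * (x + 2 * y)) ^ 2 := by ring
  nlinarith [sq_nonneg ((x - y) * (2 * x + y) * (x + 2 * y))]

theorem sPlus_pos {a b c : ℝ} (hb : 0 < b) (hc : 0 < c) : 0 < sPlus a b c := by
  unfold sPlus
  have := Real.sqrt_nonneg (b ^ 2 + 24 * a * c)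
  positivity

theorem sPlus_root {a b c : ℝ} (ha : 0 < a) (hc : 0 < c) :
    3 * a = 2 * c * sPlus a b c ^ 2 - b * sPlus a b c := by
  unfold sPlus
  have h : Real.sqrt (b ^ 2 + 24 * a * c) ^ 2 = b ^ 2 + 24 * a * c :=
    Real.sq_sqrt (by positivity)
  generalize Real.sqrt (b ^ 2 + 24 * a * c) = r at *
  field_simp
  linear_combination (-2) * h

theorem ftB_nonneg {a b c : ℝ} (ha : 0 < a) (hb : 0 < b) (hc : 0 < c) {A : Mat}
    (hA : Aᵀ = A) (htr : A.trace = 0) : 0 ≤ ftB a b c A := by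
  have hcube := trace_cube_sq_le hA htr
  have hN : 0 ≤ mnormSq A := by
    unfold mnormSq frob
    exact Finset.sum_nonneg fun i _ => Finset.sum_nonneg fun j _ => mul_self_nonneg _
  have hs := sPlus_pos (a := a) hb hc
  have hroot := sPlus_root (b := b) ha hc
  have hA3 : A * A * A = A ^ 3 := by rw [pow_three, mul_assoc]
  unfold ftB fB
  rw [hA3]
  generalize sPlus a b c = s at *
  set u := Real.sqrt (3 / 2 * mnormSq A) with hu
  have hu0 : 0 ≤ u := Real.sqrt_nonneg _
  have huN : mnormSq A = 2 / 3 * u ^ 2 := by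
    rw [hu, Real.sq_sqrt (by positivity)]; ring
  rw [huN] at hcube ⊢
  have htr3 : (A ^ 3).trace ≤ 2 / 9 * u ^ 3 := by
    refine le_of_sq_le_sq ?_ (by positivity)
    nlinarith [hcube]
  generalize (A ^ 3).trace = T at *
  have hbs : b ≤ 2 * c * s := by
    by_contra! h
    nlinarith [mul_lt_mul_of_pos_right h hs]
  have h1 : 0 ≤ (u - s) ^ 2 * (3 * c * (u + s) ^ 2 - b * (2 * u + s)) := by
    refine mul_nonneg (sq_nonneg _) ?_
    have : b * (2 * u + s) ≤ 2 * c * s * (2 * u + s) := by gcongr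
    have : 0 ≤ c * (3 * u ^ 2 + 2 * u * s + s ^ 2) := by positivity
    nlinarith
  have h2 : b * T ≤ b * (2 / 9 * u ^ 3) := by gcongr
  have ha' : a = (2 * c * s ^ 2 - b * s) / 3 := by linarith
  subst ha'
  nlinarith

theorem NSet_properties {a b c : ℝ} {A : Mat} (ha : 0 < a) (hc : 0 < c) (h : A ∈ NSet a b c) :
    Aᵀ = A ∧ A.trace = 0 ∧ ftB a b c A = 0 := by
  obtain ⟨n, hn, rfl⟩ := h
  have hroot := sPlus_root (b := b) ha hc
  simp only [dotProduct, Fin.sum_univ_three] at hn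
  refine ⟨?_, ?_, ?_⟩
  · ext i j
    simp [vecMulVec_apply, Matrix.one_apply, mul_comm, eq_comm]
  · simp only [Matrix.trace, Matrix.diag, Fin.sum_univ_three, Matrix.smul_apply, Matrix.sub_apply,
      vecMulVec_apply, Matrix.one_apply_eq, smul_eq_mul]
    linear_combination sPlus a b c * hn
  · set P : Mat := vecMulVec n n with hP
    have hPP : P * P = P := by
      rw [hP, vecMulVec_mul_vecMulVec]
      have : n ⬝ᵥ n = 1 := by simpa [dotProduct, Fin.sum_univ_three] using hn
      simp [this]
    have htP : P.trace = 1 := by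
      simpa [hP, Matrix.trace, Fin.sum_univ_three, vecMulVec_apply] using hn
    set s := sPlus a b c with hs
    have hsym : (s • (P - (1 / 3 : ℝ) • (1 : Mat)))ᵀ = s • (P - (1 / 3 : ℝ) • (1 : Mat)) := by
      ext i j
      simp [hP, vecMulVec_apply, Matrix.one_apply, mul_comm, eq_comm]
    have e2 : (P - (1 / 3 : ℝ) • (1 : Mat)) * (P - (1 / 3 : ℝ) • (1 : Mat))
        = (1 / 3 : ℝ) • P + (1 / 9 : ℝ) • (1 : Mat) := by
      simp only [mul_sub, sub_mul, hPP, Matrix.mul_smul, Matrix.smul_mul, mul_one, one_mul]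
      module
    have e3 : ((1 / 3 : ℝ) • P + (1 / 9 : ℝ) • (1 : Mat)) * (P - (1 / 3 : ℝ) • (1 : Mat))
        = (1 / 3 : ℝ) • P - (1 / 27 : ℝ) • (1 : Mat) := by
      simp only [mul_sub, add_mul, hPP, Matrix.mul_smul, Matrix.smul_mul, mul_one, one_mul]
      module
    have hm : mnormSq (s • (P - (1 / 3 : ℝ) • (1 : Mat))) = 2 / 3 * s ^ 2 := by
      rw [mnormSq_eq_trace hsym, pow_two, Matrix.smul_mul, Matrix.mul_smul, e2]
      simp [Matrix.trace_add, Matrix.trace_smul, htP]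
      ring
    have ht : (s • (P - (1 / 3 : ℝ) • (1 : Mat)) * s • (P - (1 / 3 : ℝ) • (1 : Mat)) *
        s • (P - (1 / 3 : ℝ) • (1 : Mat))).trace = 2 / 9 * s ^ 3 := by
      simp only [Matrix.smul_mul, Matrix.mul_smul, e2, e3]
      simp [Matrix.trace_sub, Matrix.trace_smul, htP]
      ring
    unfold ftB fB
    rw [hm, ht, ← hs]
    ring

/-- On symmetric traceless matrices `-J` is the gradient of the bulk energy. -/
theorem hasDerivAt_ftB {a b c : ℝ} {M : ℝ → Mat} {M' : Mat} {s : ℝ}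
    (hM : ∀ i j, HasDerivAt (fun r => M r i j) (M' i j) s)
    (hsym : ∀ᶠ r in 𝓝 s, (M r)ᵀ = M r ∧ (M r).trace = 0) :
    HasDerivAt (fun r => ftB a b c (M r))
      (-∑ i, ∑ j, Jmap a b c (M s) i j * M' i j) s := by
  obtain ⟨hS, hT⟩ := hsym.self_of_nhds
  have hS0 : ∀ i j, M s j i = M s i j := fun i j => congrFun (congrFun hS i) j
  have hS' : ∀ i j, M' j i = M' i j := fun i j =>
    ((hM i j).congr_of_eventuallyEq
      (hsym.mono fun r hr => congrFun (congrFun hr.1 i) j)).unique (hM j i) |>.symm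
  have hT' : M' 0 0 + M' 1 1 + M' 2 2 = 0 := by
    refine (((hM 0 0).add (hM 1 1)).add (hM 2 2)).unique
      ((hasDerivAt_const s (0 : ℝ)).congr_of_eventuallyEq (hsym.mono fun r hr => ?_))
    simpa [Matrix.trace, Fin.sum_univ_three] using hr.2
  have hN : HasDerivAt (fun r => mnormSq (M r)) (∑ i, ∑ j, 2 * (M s i j * M' i j)) s := by
    unfold mnormSq frob
    refine HasDerivAt.fun_sum fun i _ => HasDerivAt.fun_sum fun j _ => ?_
    exact ((hM i j).fun_mul (hM i j)).congr_deriv (by ring)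
  have hC : HasDerivAt (fun r => (M r * M r * M r).trace)
      (∑ i, ∑ j, ∑ k, ((M' i k * M s k j + M s i k * M' k j) * M s j i
        + M s i k * M s k j * M' j i)) s := by
    simp only [Matrix.trace, Matrix.diag, Matrix.mul_apply, Finset.sum_mul]
    refine HasDerivAt.fun_sum fun i _ => HasDerivAt.fun_sum fun j _ =>
      HasDerivAt.fun_sum fun k _ => ?_
    exact ((hM i k).fun_mul (hM k j)).fun_mul (hM j i)
  unfold ftB fB
  refine ((((((hN.const_mul (-(a / 2))).fun_sub (hC.const_mul (b / 3))).fun_add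
    ((hN.fun_pow 2).const_mul (c / 4))).add_const _).add_const _).sub_const _).congr_deriv ?_
  have e1 := hS0 0 1
  have e2 := hS0 0 2
  have e3 := hS0 1 2
  have f1 := hS' 0 1
  have f2 := hS' 0 2
  have f3 := hS' 1 2
  have f4 : M' 2 2 = - M' 0 0 - M' 1 1 := by linarith
  simp only [Jmap, Matrix.add_apply, Matrix.sub_apply, Matrix.smul_apply, smul_eq_mul,
    Matrix.mul_apply, Fin.sum_univ_three, Matrix.one_apply, Fin.isValue, e1, e2, e3, f1, f2, f3, f4,
    mnormSq, frob]
  simp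
  ring

/-- Directional derivative of a function of space and time. -/
def dirD (v : Vec3 × ℝ) (f : Vec3 × ℝ → ℝ) : Vec3 × ℝ → ℝ := fun p => fderiv ℝ f p v

/-- The `k`-th spatial coordinate direction in space-time. -/
def eX (k : Fin 3) : Vec3 × ℝ := (Pi.single k 1, 0)

/-- The time direction in space-time. -/
def eT : Vec3 × ℝ := (0, 1)

theorem contDiff_dirD {f : Vec3 × ℝ → ℝ} (hf : ContDiff ℝ (⊤ : ℕ∞) f) (v : Vec3 × ℝ) :
    ContDiff ℝ (⊤ : ℕ∞) (dirD v f) :=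
  (hf.fderiv_right (m := (⊤ : ℕ∞)) (by simp)).clm_apply contDiff_const

theorem dirD_comm {f : Vec3 × ℝ → ℝ} (hf : ContDiff ℝ (⊤ : ℕ∞) f) (v w : Vec3 × ℝ) :
    dirD v (dirD w f) = dirD w (dirD v f) := by
  funext p
  have hd : DifferentiableAt ℝ (fderiv ℝ f) p :=
    (hf.fderiv_right (m := (⊤ : ℕ∞)) (by simp)).differentiable (by simp) p
  have hs : IsSymmSndFDerivAt ℝ f p :=
    hf.contDiffAt.isSymmSndFDerivAt (by simpa using WithTop.coe_le_coe.2 (le_top (a := (2 : ℕ∞))))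
  have key : ∀ a b : Vec3 × ℝ, dirD a (dirD b f) p = fderiv ℝ (fderiv ℝ f) p a b := by
    intro a b
    have : dirD b f = fun q => fderiv ℝ f q b := rfl
    rw [this, dirD, fderiv_clm_apply hd (differentiableAt_const b)]
    simp
  rw [key, key, hs.eq]

theorem hasLineDerivAt_space {f : Vec3 × ℝ → ℝ} (hf : ContDiff ℝ (⊤ : ℕ∞) f) (k : Fin 3)
    (x : Vec3) (t : ℝ) :
    HasLineDerivAt ℝ (fun y => f (y, t)) (dirD (eX k) f (x, t)) x (Pi.single k 1) := by
  have h1 : HasFDerivAt f (fderiv ℝ f (x, t)) (x, t) :=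
    (hf.differentiable (by simp) (x, t)).hasFDerivAt
  have h2 := (HasFDerivAt.comp (f := fun y : Vec3 => (y, t)) x h1 (hasFDerivAt_prodMk_left x t)).hasLineDerivAt (Pi.single k 1)
  simpa [dirD, eX, Function.comp_def] using h2

theorem hasDerivAt_time {f : Vec3 × ℝ → ℝ} (hf : ContDiff ℝ (⊤ : ℕ∞) f) (x : Vec3) (t : ℝ) :
    HasDerivAt (fun s => f (x, s)) (dirD eT f (x, t)) t := by
  have h1 : HasFDerivAt f (fderiv ℝ f (x, t)) (x, t) :=
    (hf.differentiable (by simp) (x, t)).hasFDerivAt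
  have h2 := (h1.comp t (hasFDerivAt_prodMk_right x t)).hasDerivAt
  simpa [dirD, eT, Function.comp_def] using h2

theorem pd_slice {f : Vec3 × ℝ → ℝ} (hf : ContDiff ℝ (⊤ : ℕ∞) f) (k : Fin 3) (t : ℝ) :
    pd k (fun y => f (y, t)) = fun x => dirD (eX k) f (x, t) := by
  funext x
  have h1 : HasFDerivAt f (fderiv ℝ f (x, t)) (x, t) :=
    (hf.differentiable (by simp) (x, t)).hasFDerivAt
  have h2 := (HasFDerivAt.comp (f := fun y : Vec3 => (y, t)) x h1 (hasFDerivAt_prodMk_left x t)).fderiv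
  simp only [Function.comp_def] at h2
  simp [pd, h2, dirD, eX]

theorem lap_slice {f : Vec3 × ℝ → ℝ} (hf : ContDiff ℝ (⊤ : ℕ∞) f) (x : Vec3) (t : ℝ) :
    lap (fun y => f (y, t)) x = ∑ k, dirD (eX k) (dirD (eX k) f) (x, t) := by
  simp only [lap, pd_slice hf, pd_slice (contDiff_dirD hf _)]

theorem dirD_eq_zero {f : Vec3 × ℝ → ℝ} {A : ℝ} {K : Set Vec3} (hK : IsCompact K)
    (hf : ∀ x ∉ K, ∀ t, 0 < t → f (x, t) = A) (v : Vec3 × ℝ) :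
    ∀ x ∉ K, ∀ t, 0 < t → dirD v f (x, t) = 0 := by
  intro x hx t ht
  have h : f =ᶠ[𝓝 (x, t)] fun _ => A := by
    filter_upwards [(hK.isClosed.isOpen_compl.prod isOpen_Ioi).mem_nhds
      (show (x, t) ∈ Kᶜ ×ˢ Set.Ioi (0 : ℝ) from ⟨hx, ht⟩)] with p hp
    exact hf p.1 hp.1 p.2 hp.2
  simp [dirD, h.fderiv_eq]

theorem dirD_sub {f g : Vec3 × ℝ → ℝ} (hf : ContDiff ℝ (⊤ : ℕ∞) f)
    (hg : ContDiff ℝ (⊤ : ℕ∞) g) (v : Vec3 × ℝ) :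
    dirD v (fun p => f p - g p) = fun p => dirD v f p - dirD v g p := by
  funext p
  simp [dirD, fderiv_fun_sub (hf.differentiable (by simp) p) (hg.differentiable (by simp) p)]

theorem dirD_sum {ι : Type*} [Fintype ι] {f : ι → Vec3 × ℝ → ℝ}
    (hf : ∀ i, ContDiff ℝ (⊤ : ℕ∞) (f i)) (v : Vec3 × ℝ) :
    dirD v (fun p => ∑ i, f i p) = fun p => ∑ i, dirD v (f i) p := by
  funext p
  simp [dirD, fderiv_fun_sum fun i _ => (hf i).differentiable (by simp) p]

theorem integrable_of_compact_support {f : Vec3 → ℝ} {K : Set Vec3} (hK : IsCompact K)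
    (hf : Continuous f) (hz : ∀ x ∉ K, f x = 0) : Integrable f :=
  hf.integrable_of_hasCompactSupport (HasCompactSupport.intro hK hz)

theorem integral_lineDeriv_eq_zero {W W' : Vec3 → ℝ} {v : Vec3} {K : Set Vec3} (hK : IsCompact K)
    (hW : Continuous W) (hW' : Continuous W') (hd : ∀ x, HasLineDerivAt ℝ W (W' x) x v)
    (hz : ∀ x ∉ K, W x = 0) : Integrable W' ∧ ∫ x, W' x = 0 := by
  have hz' : ∀ x ∉ K, W' x = 0 := by
    intro x hx
    have : W =ᶠ[𝓝 x] fun _ => 0 := by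
      filter_upwards [hK.isClosed.isOpen_compl.mem_nhds hx] with y hy using hz y hy
    exact ((hd x).congr_of_eventuallyEq this.symm).unique (hasDerivAt_const _ _)
  have hi := integrable_of_compact_support hK hW hz
  have hi' := integrable_of_compact_support hK hW' hz'
  refine ⟨hi', ?_⟩
  have := integral_bilinear_hasLineDerivAt_right_eq_neg_left_of_integrable
    (μ := (volume : Measure Vec3)) (f := fun _ : Vec3 => (1 : ℝ)) (f' := fun _ => (0 : ℝ))
    (g := W) (g' := W') (v := v) (B := ContinuousLinearMap.mul ℝ ℝ)
    (by simp) (by simpa using hi') (by simpa using hi) (fun x _ => hasDerivAt_const _ _)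
    (fun x _ => hd x)
  simpa using this

theorem hasDerivAt_integral_of_compact_support {F F' : ℝ → Vec3 → ℝ} {K : Set Vec3} {U : Set ℝ}
    (hK : IsCompact K) (hU : IsOpen U) (hF : ∀ t ∈ U, Continuous (F t))
    (hF' : ContinuousOn (Function.uncurry F') (U ×ˢ Set.univ))
    (hd : ∀ t ∈ U, ∀ x, HasDerivAt (fun s => F s x) (F' t x) t)
    (hz : ∀ t ∈ U, ∀ x ∉ K, F t x = 0) {t : ℝ} (ht : t ∈ U) :
    Integrable (F' t) ∧ HasDerivAt (fun s => ∫ x, F s x) (∫ x, F' t x) t := by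
  have hz' : ∀ s ∈ U, ∀ x ∉ K, F' s x = 0 := by
    intro s hs x hx
    have : (fun r => F r x) =ᶠ[𝓝 s] fun _ => 0 := by
      filter_upwards [hU.mem_nhds hs] with r hr using hz r hr x hx
    exact ((hd s hs x).congr_of_eventuallyEq this.symm).unique (hasDerivAt_const s 0)
  have hF't : Continuous (F' t) := by
    rw [← continuousOn_univ]
    exact hF'.comp (f := fun x => (t, x)) (by fun_prop) fun x hx => ⟨ht, hx⟩
  obtain ⟨δ, hδ, hball⟩ := Metric.nhds_basis_closedBall.mem_iff.1 (hU.mem_nhds ht)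
  obtain ⟨C, hC⟩ := ((isCompact_closedBall t δ).prod hK).exists_bound_of_continuousOn
    (hF'.mono (Set.prod_mono hball (Set.subset_univ K)))
  refine hasDerivAt_integral_of_dominated_loc_of_deriv_le (s := Metric.closedBall t δ)
    (bound := K.indicator fun _ => C) (Metric.closedBall_mem_nhds t hδ) ?_
    (integrable_of_compact_support hK (hF t ht) (hz t ht)) hF't.aestronglyMeasurable
    (.of_forall fun x s hs => ?_) ?_ (.of_forall fun x s hs => hd s (hball hs) x)
  · filter_upwards [hU.mem_nhds ht] with s hs using (hF s hs).aestronglyMeasurable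
  · by_cases hx : x ∈ K
    · rw [Set.indicator_of_mem hx]
      exact hC (s, x) ⟨hs, hx⟩
    · rw [Set.indicator_of_notMem hx, hz' s (hball hs) x hx, norm_zero]
  · exact (integrable_indicator_iff hK.measurableSet).2
      (integrableOn_const hK.measure_ne_top)

/-- If the time derivative of a compactly supported density is bounded above by the divergence of
a compactly supported vector field, then its total integral is non-increasing in time. -/
theorem antitoneOn_integral_of_le_divergence {F F' : ℝ → Vec3 → ℝ} {W W' : Fin 3 → ℝ → Vec3 → ℝ}
    {K : Set Vec3} {S : Set ℝ} (hK : IsCompact K) (hS : Convex ℝ S)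
    (hF : ContinuousOn (Function.uncurry F) (S ×ˢ Set.univ))
    (hz : ∀ t ∈ S, ∀ x ∉ K, F t x = 0)
    (hF' : ContinuousOn (Function.uncurry F') (interior S ×ˢ Set.univ))
    (hd : ∀ t ∈ interior S, ∀ x, HasDerivAt (fun s => F s x) (F' t x) t)
    (hW : ∀ k, ∀ t ∈ interior S, Continuous (W k t))
    (hW' : ∀ k, ∀ t ∈ interior S, Continuous (W' k t))
    (hWd : ∀ k, ∀ t ∈ interior S, ∀ x, HasLineDerivAt ℝ (W k t) (W' k t x) x (Pi.single k 1))
    (hWz : ∀ k, ∀ t ∈ interior S, ∀ x ∉ K, W k t x = 0)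
    (hle : ∀ t ∈ interior S, ∀ x, F' t x ≤ ∑ k, W' k t x) :
    AntitoneOn (fun t => ∫ x, F t x) S := by
  have hslice : ∀ t ∈ S, Continuous (F t) := by
    intro t ht
    rw [← continuousOn_univ]
    exact hF.comp (f := fun x => (t, x)) (by fun_prop) fun x hx => ⟨ht, hx⟩
  have hD : ∀ t ∈ interior S, Integrable (F' t) ∧
      HasDerivAt (fun s => ∫ x, F s x) (∫ x, F' t x) t := fun t ht =>
    hasDerivAt_integral_of_compact_support hK isOpen_interior
      (fun s hs => hslice s (interior_subset hs)) hF' hd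
      (fun s hs => hz s (interior_subset hs)) ht
  refine antitoneOn_of_deriv_nonpos hS
    (continuousOn_integral_of_compact_support hK hF fun t x ht hx => hz t ht x hx)
    (fun t ht => (hD t ht).2.differentiableAt.differentiableWithinAt) fun t ht => ?_
  rw [(hD t ht).2.deriv]
  have hI := fun k => integral_lineDeriv_eq_zero hK (hW k t ht) (hW' k t ht) (hWd k t ht)
    (hWz k t ht)
  calc ∫ x, F' t x ≤ ∫ x, ∑ k, W' k t x :=
        integral_mono (hD t ht).1 (integrable_finsetSum _ fun k _ => (hI k).1) (hle t ht)
    _ = 0 := by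
        rw [integral_finsetSum _ fun k _ => (hI k).1]
        exact Finset.sum_eq_zero fun k _ => (hI k).2

/-- Uniqueness for compactly supported solutions of linear parabolic systems. -/
theorem eq_zero_of_parabolic {ι : Type*} [Fintype ι] {u : ι → Vec3 × ℝ → ℝ} {K : Set Vec3}
    {κ C T : ℝ} (hκ : 0 ≤ κ) (hu : ∀ i, ContDiff ℝ (⊤ : ℕ∞) (u i)) (hK : IsCompact K)
    (hz : ∀ i, ∀ x ∉ K, ∀ t, 0 ≤ t → u i (x, t) = 0) (h0 : ∀ i x, u i (x, 0) = 0)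
    (hC : ∀ x t, 0 < t → t < T →
      ∑ i, u i (x, t) * (dirD eT (u i) (x, t) - κ * ∑ k, dirD (eX k) (dirD (eX k) (u i)) (x, t))
        ≤ C * ∑ i, u i (x, t) ^ 2) :
    ∀ i x t, 0 ≤ t → t ≤ T → u i (x, t) = 0 := by
  have hc : ∀ i, Continuous (u i) := fun i => (hu i).continuous
  have hcD : ∀ i v, Continuous (dirD v (u i)) := fun i v => (contDiff_dirD (hu i) v).continuous
  have hcDD : ∀ i v w, Continuous (dirD w (dirD v (u i))) := fun i v w =>
    (contDiff_dirD (contDiff_dirD (hu i) v) w).continuous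
  have hanti := antitoneOn_integral_of_le_divergence
    (F := fun t x => Real.exp (-2 * C * t) * ∑ i, u i (x, t) ^ 2)
    (F' := fun t x => Real.exp (-2 * C * t) * (-2 * C) * ∑ i, u i (x, t) ^ 2
      + Real.exp (-2 * C * t) * ∑ i, 2 * u i (x, t) * dirD eT (u i) (x, t))
    (W := fun k t x => 2 * κ * Real.exp (-2 * C * t) * ∑ i, u i (x, t) * dirD (eX k) (u i) (x, t))
    (W' := fun k t x => 2 * κ * Real.exp (-2 * C * t) * ∑ i,
      (dirD (eX k) (u i) (x, t) ^ 2 + u i (x, t) * dirD (eX k) (dirD (eX k) (u i)) (x, t)))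
    (S := Set.Icc 0 T) hK (convex_Icc 0 T)
    (Continuous.continuousOn (by simp only [Function.uncurry_def]; fun_prop))
    (fun t ht x hx => by simp [hz _ x hx t ht.1])
    (Continuous.continuousOn (by simp only [Function.uncurry_def]; fun_prop))
    (fun t ht x => ?_) (fun k t ht => by fun_prop) (fun k t ht => by fun_prop)
    (fun k t ht x => ?_)
    (fun k t ht x hx => by simp [hz _ x hx t (interior_subset ht).1]) (fun t ht x => ?_)
  · intro i x t ht htT
    have h1 := hanti (Set.left_mem_Icc.2 (ht.trans htT)) ⟨ht, htT⟩ ht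
    simp only [h0] at h1
    have hcont : Continuous fun x => Real.exp (-2 * C * t) * ∑ i, u i (x, t) ^ 2 := by fun_prop
    have hnn : ∀ x, 0 ≤ Real.exp (-2 * C * t) * ∑ i, u i (x, t) ^ 2 := fun x => by positivity
    have h2 : ∫ x, Real.exp (-2 * C * t) * ∑ i, u i (x, t) ^ 2 = 0 :=
      le_antisymm (by simpa using h1) (integral_nonneg hnn)
    rw [integral_eq_zero_iff_of_nonneg hnn (integrable_of_compact_support hK hcont
      fun x hx => by simp [hz _ x hx t ht])] at h2
    have h3 := congrFun ((hcont.ae_eq_iff_eq volume continuous_zero).1 h2) x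
    simp only [Pi.zero_apply, mul_eq_zero, Real.exp_ne_zero, false_or] at h3
    exact pow_eq_zero_iff two_ne_zero |>.1
      ((Finset.sum_eq_zero_iff_of_nonneg fun i _ => sq_nonneg _).1 h3 i (Finset.mem_univ i))
  · have he : HasDerivAt (fun s => Real.exp (-2 * C * s)) (Real.exp (-2 * C * t) * (-2 * C)) t := by
      simpa using ((hasDerivAt_id t).const_mul (-2 * C)).exp
    refine he.mul (HasDerivAt.fun_sum fun i _ => ?_)
    simpa using (hasDerivAt_time (hu i) x t).fun_pow 2
  · have hsum : HasLineDerivAt ℝ (fun y => ∑ i, u i (y, t) * dirD (eX k) (u i) (y, t))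
        (∑ i, (dirD (eX k) (u i) (x, t) ^ 2
          + u i (x, t) * dirD (eX k) (dirD (eX k) (u i)) (x, t))) x (Pi.single k 1) := by
      refine HasDerivAt.fun_sum fun i _ => ?_
      refine (HasDerivAt.fun_mul (hasLineDerivAt_space (hu i) k x t)
        (hasLineDerivAt_space (contDiff_dirD (hu i) _) k x t)).congr_deriv ?_
      simp [pow_two]
    exact HasDerivAt.const_mul (2 * κ * Real.exp (-2 * C * t)) hsum
  · rw [interior_Icc] at ht
    have h1 := hC x t ht.1 ht.2
    have hE := Real.exp_pos (-2 * C * t)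
    generalize Real.exp (-2 * C * t) = E at hE ⊢
    have h2 : 0 ≤ κ * ∑ i, ∑ k, dirD (eX k) (u i) (x, t) ^ 2 := by positivity
    simp only [← Finset.mul_sum, mul_sub, Finset.sum_sub_distrib, mul_assoc] at h1 ⊢
    rw [Finset.sum_comm]
    simp only [Finset.sum_add_distrib, ← Finset.mul_sum]
    have h3 : ∑ i, u i (x, t) * (κ * ∑ k, dirD (eX k) (dirD (eX k) (u i)) (x, t))
        = κ * ∑ i, u i (x, t) * ∑ k, dirD (eX k) (dirD (eX k) (u i)) (x, t) := by
      rw [Finset.mul_sum]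
      exact Finset.sum_congr rfl fun i _ => by ring
    rw [h3] at h1
    nlinarith [mul_le_mul_of_nonneg_left h1 hE.le, mul_nonneg h2 hE.le]

theorem Jmap_antisymm_le {a b c M : ℝ} (hb : 0 < b) (hc : 0 < c) (A : Mat)
    (hM : ∀ i j, |A i j| ≤ M) :
    ∑ i, ∑ j, (A i j - A j i) * (Jmap a b c A i j - Jmap a b c A j i)
      ≤ (a + 6 * b * M) * ∑ i, ∑ j, (A i j - A j i) ^ 2 := by
  have hN : 0 ≤ mnormSq A := by
    unfold mnormSq frob
    exact Finset.sum_nonneg fun i _ => Finset.sum_nonneg fun j _ => mul_self_nonneg _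
  have hJ : ∀ i j, Jmap a b c A i j - Jmap a b c A j i = (a - c * mnormSq A) * (A i j - A j i)
      + b * ∑ k, (A i k * (A k j - A j k) + (A i k - A k i) * A j k) := by
    intro i j
    simp only [Jmap, Matrix.add_apply, Matrix.sub_apply, Matrix.smul_apply, smul_eq_mul,
      Matrix.mul_apply, Matrix.one_apply, Fin.sum_univ_three, eq_comm (a := i)]
    ring
  have hmul : ∀ r u v : ℝ, |r| ≤ M → r * (u * v) ≤ M * (u ^ 2 / 2 + v ^ 2 / 2) := by
    intro r u v hr
    calc r * (u * v) ≤ |r| * |u * v| := by rw [← abs_mul]; exact le_abs_self _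
      _ ≤ M * (u ^ 2 / 2 + v ^ 2 / 2) := by
        refine mul_le_mul hr ?_ (abs_nonneg _) ((abs_nonneg r).trans hr)
        rw [abs_mul]
        nlinarith [sq_nonneg (|u| - |v|), sq_abs u, sq_abs v]
  have hS : 0 ≤ ∑ i, ∑ j, (A i j - A j i) ^ 2 := by positivity
  have hterm : ∑ i, ∑ j, ∑ k,
      (A i k * ((A i j - A j i) * (A k j - A j k)) + A j k * ((A i j - A j i) * (A i k - A k i)))
      ≤ ∑ i, ∑ j, ∑ k, (M * ((A i j - A j i) ^ 2 / 2 + (A k j - A j k) ^ 2 / 2)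
        + M * ((A i j - A j i) ^ 2 / 2 + (A i k - A k i) ^ 2 / 2)) :=
    Finset.sum_le_sum fun i _ => Finset.sum_le_sum fun j _ => Finset.sum_le_sum fun k _ =>
      add_le_add (hmul _ _ _ (hM i k)) (hmul _ _ _ (hM j k))
  have hR : ∑ i, ∑ j, ∑ k, (M * ((A i j - A j i) ^ 2 / 2 + (A k j - A j k) ^ 2 / 2)
        + M * ((A i j - A j i) ^ 2 / 2 + (A i k - A k i) ^ 2 / 2))
      = 6 * M * ∑ i, ∑ j, (A i j - A j i) ^ 2 := by
    simp only [Fin.sum_univ_three]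
    ring
  have hL : ∑ i, ∑ j, (A i j - A j i) * (Jmap a b c A i j - Jmap a b c A j i)
      = (a - c * mnormSq A) * ∑ i, ∑ j, (A i j - A j i) ^ 2 + b * ∑ i, ∑ j, ∑ k,
      (A i k * ((A i j - A j i) * (A k j - A j k))
        + A j k * ((A i j - A j i) * (A i k - A k i))) := by
    simp only [hJ, Finset.mul_sum, ← Finset.sum_add_distrib]
    refine Finset.sum_congr rfl fun i _ => Finset.sum_congr rfl fun j _ => ?_
    rw [mul_add, Finset.mul_sum]
    congr 1
    · ring
    · exact Finset.sum_congr rfl fun k _ => by ring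
  rw [hR] at hterm
  rw [hL]
  nlinarith [mul_le_mul_of_nonneg_left hterm hb.le, mul_nonneg (mul_nonneg hc.le hN) hS]

section Flow

variable {a b c Γ L1 ε : ℝ} {Q : Vec3 → ℝ → Mat}

/-- The flow equation in terms of space-time directional derivatives. -/
theorem IsSolution.dirD_eT (hsol : IsSolution a b c Γ L1 ε Q (Set.Ici 0)) (i j : Fin 3)
    (x : Vec3) {t : ℝ} (ht : 0 ≤ t) :
    dirD eT (fun p => Q p.1 p.2 i j) (x, t) = 1 / (ε * Γ) * Jmap a b c (Q x t) i j
      + L1 / Γ * ∑ k, dirD (eX k) (dirD (eX k) fun p => Q p.1 p.2 i j) (x, t) := by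
  rw [← (hasDerivAt_time (hsol.1 i j) x t).deriv, ← lap_slice (hsol.1 i j) x t]
  exact hsol.2 x t ht i j

theorem IsSolution.isSymm (hb : 0 < b) (hc : 0 < c) (hΓ : 0 < Γ) (hL1 : 0 < L1) (hε : 0 < ε)
    (hsol : IsSolution a b c Γ L1 ε Q (Set.Ici 0)) {A : Mat} (hA : Aᵀ = A) {K : Set Vec3}
    (hK : IsCompact K) (hQ : ∀ x ∉ K, ∀ t ∈ Set.Ici (0 : ℝ), Q x t = A)
    (h0 : ∀ x, (Q x 0)ᵀ = Q x 0) {x : Vec3} {t : ℝ} (ht : 0 ≤ t) : (Q x t)ᵀ = Q x t := by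
  have hsymm : ∀ {B : Mat}, Bᵀ = B → ∀ i j, B j i = B i j := fun h i j =>
    congrFun (congrFun h i) j
  have hcont : ∀ i j, Continuous fun p : Vec3 × ℝ => Q p.1 p.2 i j := fun i j =>
    (hsol.1 i j).continuous
  obtain ⟨M, hM⟩ := (hK.prod (isCompact_Icc (a := 0) (b := t))).exists_bound_of_continuousOn
    (f := fun p : Vec3 × ℝ => ∑ i, ∑ j, |Q p.1 p.2 i j|)
    (Continuous.continuousOn (by fun_prop))
  have hzero : ∀ i j, ∀ y ∉ K, ∀ s, 0 ≤ s → Q y s i j - Q y s j i = 0 := by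
    intro i j y hy s hs
    rw [hQ y hy s hs, hsymm hA, sub_self]
  have key := eq_zero_of_parabolic (ι := Fin 3 × Fin 3) (κ := L1 / Γ)
    (u := fun m p => Q p.1 p.2 m.1 m.2 - Q p.1 p.2 m.2 m.1)
    (C := 1 / (ε * Γ) * (a + 6 * b * M)) (T := t)
    (by positivity) (fun m => (hsol.1 _ _).sub (hsol.1 _ _)) hK
    (fun m => hzero m.1 m.2) (fun m y => by rw [hsymm (h0 y), sub_self]) ?_
  · ext i j
    rw [Matrix.transpose_apply]
    linarith [key (j, i) x t ht le_rfl]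
  · intro y s hs hst
    by_cases hy : y ∈ K
    · have hMs : ∀ i j, |Q y s i j| ≤ M := by
        intro i j
        have h1 := (le_abs_self _).trans (hM (y, s) ⟨hy, hs.le, hst.le⟩)
        refine le_trans ?_ h1
        refine le_trans ?_ (Finset.single_le_sum (f := fun i => ∑ j, |Q y s i j|)
          (fun i _ => Finset.sum_nonneg fun j _ => abs_nonneg _) (Finset.mem_univ i))
        exact Finset.single_le_sum (f := fun j => |Q y s i j|)
          (fun j _ => abs_nonneg _) (Finset.mem_univ j)
      have h2 := mul_le_mul_of_nonneg_left (Jmap_antisymm_le (a := a) hb hc (Q y s) hMs)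
        (show 0 ≤ 1 / (ε * Γ) by positivity)
      simp only [Fintype.sum_prod_type]
      rw [mul_assoc]
      refine le_of_eq_of_le ?_ h2
      simp only [Finset.mul_sum]
      refine Finset.sum_congr rfl fun i _ => Finset.sum_congr rfl fun j _ => ?_
      simp only [dirD_sub (hsol.1 _ _) (hsol.1 _ _),
        dirD_sub (contDiff_dirD (hsol.1 _ _) _) (contDiff_dirD (hsol.1 _ _) _),
        hsol.dirD_eT _ _ _ hs.le, ← Finset.mul_sum, Finset.sum_sub_distrib]
      ring
    · simp [hzero _ _ y hy s hs.le]

theorem IsSolution.trace_eq_zero (hc : 0 < c) (hΓ : 0 < Γ) (hL1 : 0 < L1) (hε : 0 < ε)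
    (hsol : IsSolution a b c Γ L1 ε Q (Set.Ici 0)) {A : Mat} (hA : A.trace = 0) {K : Set Vec3}
    (hK : IsCompact K) (hQ : ∀ x ∉ K, ∀ t ∈ Set.Ici (0 : ℝ), Q x t = A)
    (hsymm : ∀ x t, 0 ≤ t → (Q x t)ᵀ = Q x t)
    (h0 : ∀ x, (Q x 0).trace = 0) {x : Vec3} {t : ℝ} (ht : 0 ≤ t) : (Q x t).trace = 0 := by
  have key := eq_zero_of_parabolic (ι := Unit) (κ := L1 / Γ)
    (u := fun _ p => ∑ i, Q p.1 p.2 i i) (C := 1 / (ε * Γ) * a) (T := t)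
    (by positivity) (fun _ => ContDiff.sum fun i _ => hsol.1 i i) hK
    (fun _ y hy s hs => by simpa [Matrix.trace, hQ y hy s hs] using hA)
    (fun _ y => by simpa [Matrix.trace] using h0 y) ?_
  · simpa [Matrix.trace] using key () x t ht le_rfl
  · intro y s hs _
    have hN : 0 ≤ mnormSq (Q y s) := by
      unfold mnormSq frob
      exact Finset.sum_nonneg fun i _ => Finset.sum_nonneg fun j _ => mul_self_nonneg _
    have hJ : ∑ i, Jmap a b c (Q y s) i i = (a - c * mnormSq (Q y s)) * ∑ i, Q y s i i := by
      have h1 : ∑ i, (Q y s * Q y s) i i = mnormSq (Q y s) := by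
        rw [mnormSq_eq_trace (hsymm y s hs.le), pow_two]
        rfl
      simp only [Fin.sum_univ_three] at h1 ⊢
      simp only [Jmap, Matrix.add_apply, Matrix.sub_apply, Matrix.smul_apply, smul_eq_mul,
        Matrix.one_apply_eq]
      linear_combination b * h1
    have hd : dirD eT (fun p => ∑ i, Q p.1 p.2 i i) (y, s) - L1 / Γ * ∑ k,
        dirD (eX k) (dirD (eX k) fun p => ∑ i, Q p.1 p.2 i i) (y, s)
        = 1 / (ε * Γ) * ∑ i, Jmap a b c (Q y s) i i := by
      simp only [dirD_sum fun i => hsol.1 i i,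
        dirD_sum fun i => contDiff_dirD (hsol.1 i i) _, hsol.dirD_eT _ _ _ hs.le]
      rw [Finset.sum_comm]
      simp only [Finset.sum_add_distrib, ← Finset.mul_sum]
      ring
    simp only [Finset.univ_unique, Finset.sum_singleton, hd, hJ]
    have h2 : 0 ≤ 1 / (ε * Γ) * (c * mnormSq (Q y s) * (∑ i, Q y s i i) ^ 2) := by positivity
    nlinarith

end Flow

theorem hasLineDerivAt_Gk (Γ L1 t₀ t : ℝ) (x₀ x : Vec3) (k : Fin 3) :
    HasLineDerivAt ℝ (fun y => Gk Γ L1 x₀ t₀ y t)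
      (-(x k - x₀ k) / (2 * (L1 / Γ) * (t₀ - t)) * Gk Γ L1 x₀ t₀ x t) x (Pi.single k 1) := by
  have hco : ∀ i, HasDerivAt (fun s : ℝ => ((x + s • (Pi.single k 1 : Vec3)) i - x₀ i) ^ 2)
      (2 * (x i - x₀ i) * (Pi.single k 1 : Vec3) i) 0 := by
    intro i
    have h1 : HasDerivAt (fun s : ℝ => (x + s • (Pi.single k 1 : Vec3)) i - x₀ i)
        ((Pi.single k 1 : Vec3) i) 0 := by
      simpa using (((hasDerivAt_id (0 : ℝ)).mul_const ((Pi.single k 1 : Vec3) i)).const_add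
        (x i)).sub_const (x₀ i)
    simpa using h1.fun_pow 2
  have hs := HasDerivAt.fun_sum (u := Finset.univ) fun i _ => hco i
  have he := ((hs.fun_neg.div_const (4 * (L1 / Γ) * (t₀ - t))).exp).const_mul
    ((4 * Real.pi * (L1 / Γ) * (t₀ - t)) ^ (-(3 : ℝ) / 2))
  refine HasDerivAt.congr_deriv he ?_
  simp only [Gk, zero_smul, add_zero, Pi.single_apply, mul_ite, mul_one, mul_zero,
    Finset.sum_ite_eq', Finset.mem_univ, if_true]
  generalize (4 * Real.pi * (L1 / Γ) * (t₀ - t)) ^ (-(3 : ℝ) / 2) = P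
  generalize Real.exp _ = E
  generalize L1 / Γ = κ
  generalize t₀ - t = τ
  ring

theorem hasDerivAt_Gk {Γ L1 t₀ t : ℝ} (hΓ : 0 < Γ) (hL1 : 0 < L1) (ht : t < t₀) (x₀ x : Vec3) :
    HasDerivAt (fun s => Gk Γ L1 x₀ t₀ x s)
      ((3 / (2 * (t₀ - t)) - (∑ i, (x i - x₀ i) ^ 2) / (4 * (L1 / Γ) * (t₀ - t) ^ 2))
        * Gk Γ L1 x₀ t₀ x t) t := by
  have hτ : 0 < t₀ - t := sub_pos.2 ht
  have hκ : 0 < L1 / Γ := div_pos hL1 hΓ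
  have hsub : HasDerivAt (fun s => t₀ - s) (-1) t := by
    simpa using (hasDerivAt_id t).const_sub t₀
  have hbase : 0 < 4 * Real.pi * (L1 / Γ) * (t₀ - t) := by positivity
  have hp := (hsub.const_mul (4 * Real.pi * (L1 / Γ))).rpow_const
    (p := -(3 : ℝ) / 2) (Or.inl hbase.ne')
  have he := ((hasDerivAt_const t (-(∑ i, (x i - x₀ i) ^ 2))).fun_div
    (hsub.const_mul (4 * (L1 / Γ))) (by positivity)).exp
  refine (hp.fun_mul he).congr_deriv ?_
  rw [Real.rpow_sub_one hbase.ne']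
  unfold Gk
  generalize (4 * Real.pi * (L1 / Γ) * (t₀ - t)) ^ (-(3 : ℝ) / 2) = P
  generalize (∑ i, (x i - x₀ i) ^ 2) = S
  generalize L1 / Γ = κ at *
  generalize t₀ - t = τ at *
  generalize Real.exp _ = E
  have := Real.pi_pos
  field_simp
  ring

theorem Gk_pos {Γ L1 t₀ t : ℝ} (hΓ : 0 < Γ) (hL1 : 0 < L1) (ht : t < t₀) (x₀ x : Vec3) :
    0 < Gk Γ L1 x₀ t₀ x t := by
  have hτ : 0 < t₀ - t := sub_pos.2 ht
  have := Real.pi_pos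
  unfold Gk
  positivity

theorem continuousOn_Gk {Γ L1 t₀ : ℝ} (hΓ : 0 < Γ) (hL1 : 0 < L1) (x₀ : Vec3) :
    ContinuousOn (fun p : ℝ × Vec3 => Gk Γ L1 x₀ t₀ p.2 p.1) (Set.Iio t₀ ×ˢ Set.univ) := by
  have hne : ∀ p ∈ Set.Iio t₀ ×ˢ (Set.univ : Set Vec3), t₀ - p.1 ≠ 0 := fun p hp =>
    (sub_pos.2 hp.1).ne'
  have hκ : L1 / Γ ≠ 0 := (div_pos hL1 hΓ).ne'
  have hπ := Real.pi_ne_zero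
  unfold Gk
  refine ContinuousOn.mul (ContinuousOn.rpow_const (by fun_prop) fun p hp => Or.inl ?_)
    (ContinuousOn.rexp (ContinuousOn.div (by fun_prop) (by fun_prop) fun p hp => ?_))
  · exact mul_ne_zero (by positivity) (hne p hp)
  · exact mul_ne_zero (by positivity) (hne p hp)

/-- The `k`-th component of the vector field whose divergence, weighted by the backward heat
kernel, controls the time derivative of the weighted Dirichlet energy of one component. -/
def flux (κ τ : ℝ) (x₀ : Vec3) (f : Vec3 × ℝ → ℝ) (k : Fin 3) (p : Vec3 × ℝ) : ℝ :=
  τ * κ * (dirD (eX k) f p * dirD eT f p)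
    - κ / 2 * (dirD (eX k) f p * ∑ l, (p.1 l - x₀ l) * dirD (eX l) f p)
    + κ / 4 * ((p.1 k - x₀ k) * ∑ l, dirD (eX l) f p ^ 2)

/-- The derivative of `flux κ τ x₀ f k` in the `k`-th spatial direction. -/
def fluxDeriv (κ τ : ℝ) (x₀ : Vec3) (f : Vec3 × ℝ → ℝ) (k : Fin 3) (p : Vec3 × ℝ) : ℝ :=
  τ * κ * (dirD (eX k) (dirD (eX k) f) p * dirD eT f p
      + dirD (eX k) f p * dirD (eX k) (dirD eT f) p)
    - κ / 2 * (dirD (eX k) (dirD (eX k) f) p * ∑ l, (p.1 l - x₀ l) * dirD (eX l) f p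
      + dirD (eX k) f p * (dirD (eX k) f p
        + ∑ l, (p.1 l - x₀ l) * dirD (eX k) (dirD (eX l) f) p))
    + κ / 4 * (∑ l, dirD (eX l) f p ^ 2
      + (p.1 k - x₀ k) * ∑ l, 2 * dirD (eX l) f p * dirD (eX k) (dirD (eX l) f) p)

theorem hasLineDerivAt_coord (x₀ x : Vec3) (k l : Fin 3) :
    HasLineDerivAt ℝ (fun y : Vec3 => y l - x₀ l) ((Pi.single k 1 : Vec3) l) x
      (Pi.single k 1) := by
  unfold HasLineDerivAt
  simpa using (((hasDerivAt_id (0 : ℝ)).mul_const ((Pi.single k 1 : Vec3) l)).const_add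
    (x l)).sub_const (x₀ l)

theorem hasLineDerivAt_flux {f : Vec3 × ℝ → ℝ} (hf : ContDiff ℝ (⊤ : ℕ∞) f) (κ τ : ℝ)
    (x₀ x : Vec3) (t : ℝ) (k : Fin 3) :
    HasLineDerivAt ℝ (fun y => flux κ τ x₀ f k (y, t)) (fluxDeriv κ τ x₀ f k (x, t)) x
      (Pi.single k 1) := by
  have hX := fun l => hasLineDerivAt_space (contDiff_dirD hf (eX l)) k x t
  have hT := hasLineDerivAt_space (contDiff_dirD hf eT) k x t
  have hY := HasDerivAt.fun_sum (u := Finset.univ) fun l _ =>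
    HasDerivAt.fun_mul (hasLineDerivAt_coord x₀ x k l) (hX l)
  have hS := HasDerivAt.fun_sum (u := Finset.univ) fun l _ => HasDerivAt.fun_pow (hX l) 2
  have h1 := (HasDerivAt.fun_mul (hX k) hT).const_mul (τ * κ)
  have h2 := (HasDerivAt.fun_mul (hX k) hY).const_mul (κ / 2)
  have h3 := (HasDerivAt.fun_mul (hasLineDerivAt_coord x₀ x k k) hS).const_mul (κ / 4)
  refine HasDerivAt.congr_deriv ((h1.fun_sub h2).fun_add h3) ?_
  simp [fluxDeriv, Finset.sum_add_distrib, Pi.single_apply]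

/-- Pointwise divergence inequality for one component of the flow. -/
theorem dirichlet_density_le_divergence {f : Vec3 × ℝ → ℝ} (hf : ContDiff ℝ (⊤ : ℕ∞) f)
    {κ τ g P : ℝ} (hκ : 0 < κ) (hτ : 0 < τ) (hg : 0 ≤ g) (x₀ : Vec3) (p : Vec3 × ℝ)
    (hP : dirD eT f p = P + κ * ∑ k, dirD (eX k) (dirD (eX k) f) p) :
    (-(κ / 2 * ∑ k, dirD (eX k) f p ^ 2)
        + τ * (κ / 2 * ∑ k, 2 * dirD (eX k) f p * dirD eT (dirD (eX k) f) p)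
        + (κ / 2 * ∑ k, dirD (eX k) f p ^ 2)
          * (3 / 2 - (∑ i, (p.1 i - x₀ i) ^ 2) / (4 * κ * τ))) * g
      ≤ (∑ k, (-(p.1 k - x₀ k) / (2 * κ * τ) * g * flux κ τ x₀ f k p
          + g * fluxDeriv κ τ x₀ f k p))
        + g * ((τ * dirD eT f p - (∑ l, (p.1 l - x₀ l) * dirD (eX l) f p) / 2) * P) := by
  rw [← sub_nonneg]
  have hsq : 0 ≤ g * (τ * (dirD eT f p
      - (∑ l, (p.1 l - x₀ l) * dirD (eX l) f p) / (2 * τ)) ^ 2) := by positivity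
  refine le_of_le_of_eq hsq ?_
  obtain rfl : P = dirD eT f p - κ * ∑ k, dirD (eX k) (dirD (eX k) f) p := by linarith
  simp only [flux, fluxDeriv, Fin.sum_univ_three, dirD_comm hf eT, dirD_comm hf (eX 1) (eX 0),
    dirD_comm hf (eX 2) (eX 0), dirD_comm hf (eX 2) (eX 1)]
  field_simp
  ring

theorem eDens_eq {a b c Γ L1 ε : ℝ} {Q : Vec3 → ℝ → Mat}
    (hQ : ∀ i j, ContDiff ℝ (⊤ : ℕ∞) fun p : Vec3 × ℝ => Q p.1 p.2 i j) (x : Vec3) (t : ℝ) :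
    eDens a b c Γ L1 ε Q x t = ftB a b c (Q x t) / (ε * Γ)
      + ∑ i, ∑ j, L1 / Γ / 2 * ∑ k, dirD (eX k) (fun p => Q p.1 p.2 i j) (x, t) ^ 2 := by
  have h : ∀ i j k, pd k (fun y => Q y t i j) x
      = dirD (eX k) (fun p => Q p.1 p.2 i j) (x, t) := fun i j k =>
    congrFun (pd_slice (hQ i j) k t) x
  simp only [eDens, gradSq, h, Fin.sum_univ_three]
  ring

theorem continuous_ftB (a b c : ℝ) : Continuous (ftB a b c) := by
  unfold ftB fB mnormSq frob
  fun_prop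

theorem continuous_Jmap (a b c : ℝ) (i j : Fin 3) : Continuous fun A => Jmap a b c A i j := by
  unfold Jmap mnormSq frob
  simp only [Matrix.add_apply, Matrix.sub_apply, Matrix.smul_apply, smul_eq_mul, Matrix.mul_apply]
  fun_prop

/-- Algebraic summation of the componentwise divergence inequalities, including the contribution
of the bulk energy `φ`. -/
theorem energy_density_le_divergence {κ τ N g φ : ℝ} (hκ : 0 < κ) (hτ : 0 < τ) (hN : 0 < N)
    (hg : 0 ≤ g) (hφ : 0 ≤ φ) (y : Fin 3 → ℝ) (e e' J qt : Fin 3 → Fin 3 → ℝ)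
    (qx α : Fin 3 → Fin 3 → Fin 3 → ℝ)
    (h : ∑ i, ∑ j, (-e i j + τ * e' i j + e i j * (3 / 2 - (∑ k, y k ^ 2) / (4 * κ * τ))) * g
      ≤ ∑ i, ∑ j, ((∑ k, α k i j)
        + g * ((τ * qt i j - (∑ l, y l * qx l i j) / 2) * (1 / N * J i j)))) :
    (-(φ / N + ∑ i, ∑ j, e i j)
        + τ * ((-∑ i, ∑ j, J i j * qt i j) / N + ∑ i, ∑ j, e' i j)) * g
      + τ * (φ / N + ∑ i, ∑ j, e i j)
        * ((3 / (2 * τ) - (∑ k, y k ^ 2) / (4 * κ * τ ^ 2)) * g)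
      ≤ ∑ k, (∑ i, ∑ j, α k i j + (-(y k) / (2 * κ * τ) * g * (y k * φ)
        + g * (1 * φ + y k * (-∑ i, ∑ j, J i j * qx k i j))) * (1 / (2 * N))) := by
  have h1 : 0 ≤ g * φ / N := by positivity
  rw [← sub_nonneg] at h ⊢
  refine le_of_le_of_eq (add_nonneg h h1) ?_
  simp only [Fin.sum_univ_three]
  field_simp
  ring

/-- Along the flow, the energy weighted by the scaled backward heat kernel and the remaining time
is non-increasing in time. -/
theorem antitoneOn_weightedEnergy {a b c Γ L1 ε : ℝ} {Q : Vec3 → ℝ → Mat}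
    (ha : 0 < a) (hb : 0 < b) (hc : 0 < c) (hΓ : 0 < Γ) (hL1 : 0 < L1) (hε : 0 < ε)
    (hsol : IsSolution a b c Γ L1 ε Q (Set.Ici 0)) {A : Mat} {K : Set Vec3}
    (hK : IsCompact K) (hQ : ∀ x ∉ K, ∀ t ∈ Set.Ici (0 : ℝ), Q x t = A) (hA : ftB a b c A = 0)
    (hsymm : ∀ x t, 0 ≤ t → (Q x t)ᵀ = Q x t) (htr : ∀ x t, 0 ≤ t → (Q x t).trace = 0)
    (x₀ : Vec3) (t₀ : ℝ) :
    AntitoneOn (fun t => ∫ x, (t₀ - t) * eDens a b c Γ L1 ε Q x t * Gk Γ L1 x₀ t₀ x t)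
      (Set.Ioo 0 t₀) := by
  have hsm := hsol.1
  have hκ : 0 < L1 / Γ := div_pos hL1 hΓ
  have hεΓ : 0 < ε * Γ := mul_pos hε hΓ
  simp only [eDens_eq hsm]
  set q : Fin 3 → Fin 3 → Vec3 × ℝ → ℝ := fun i j p => Q p.1 p.2 i j with hq
  have hqs : ∀ i j, ContDiff ℝ (⊤ : ℕ∞) (q i j) := hsm
  have hcD : ∀ i j v, Continuous (dirD v (q i j)) := fun i j v =>
    (contDiff_dirD (hqs i j) v).continuous
  have hcDD : ∀ i j v w, Continuous (dirD w (dirD v (q i j))) := fun i j v w =>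
    (contDiff_dirD (contDiff_dirD (hqs i j) v) w).continuous
  have hQc : Continuous fun p : Vec3 × ℝ => Q p.1 p.2 :=
    continuous_matrix fun i j => (hqs i j).continuous
  have hQc' : ∀ t, Continuous fun x => Q x t := fun t =>
    hQc.comp (f := fun x : Vec3 => (x, t)) (by fun_prop)
  have hQct : Continuous fun p : ℝ × Vec3 => Q p.2 p.1 :=
    hQc.comp (f := fun p : ℝ × Vec3 => (p.2, p.1)) (by fun_prop)
  have hφc := fun t => (continuous_ftB a b c).comp (hQc' t)
  have hφct := (continuous_ftB a b c).comp hQct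
  have hJc := fun t i j => (continuous_Jmap a b c i j).comp (hQc' t)
  have hJct := fun i j => (continuous_Jmap a b c i j).comp hQct
  simp only [Function.comp_def] at hφc hφct hJc hJct
  have hGct := continuousOn_Gk (t₀ := t₀) hΓ hL1 x₀
  have hGc : ∀ t, Continuous fun x => Gk Γ L1 x₀ t₀ x t := fun t => by
    unfold Gk
    fun_prop
  have hD0 : ∀ i j v, ∀ x ∉ K, ∀ t, 0 < t → dirD v (q i j) (x, t) = 0 := fun i j v =>
    dirD_eq_zero (A := A i j) hK (fun x hx t ht => by rw [hq]; simp only [hQ x hx t ht.le]) v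
  have hflux0 : ∀ i j k, ∀ x ∉ K, ∀ t, 0 < t → ∀ τ,
      flux (L1 / Γ) τ x₀ (q i j) k (x, t) = 0 := fun i j k x hx t ht τ => by
    simp [flux, hD0 i j _ x hx t ht]
  have hfluxc : ∀ i j k t τ, Continuous fun x => flux (L1 / Γ) τ x₀ (q i j) k (x, t) :=
    fun i j k t τ => by
      unfold flux
      fun_prop
  have hfluxDc : ∀ i j k t τ, Continuous fun x => fluxDeriv (L1 / Γ) τ x₀ (q i j) k (x, t) :=
    fun i j k t τ => by
      unfold fluxDeriv
      fun_prop
  have hφx : ∀ k x t, 0 < t → HasLineDerivAt ℝ (fun y => ftB a b c (Q y t))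
      (-∑ i, ∑ j, Jmap a b c (Q x t) i j * dirD (eX k) (q i j) (x, t)) x (Pi.single k 1) := by
    intro k x t ht
    have h := hasDerivAt_ftB (a := a) (b := b) (c := c) (s := 0)
      (M := fun s : ℝ => Q (x + s • (Pi.single k 1 : Vec3)) t)
      (M' := fun i j => dirD (eX k) (q i j) (x, t))
      (fun i j => hasLineDerivAt_space (hqs i j) k x t)
      (.of_forall fun s => ⟨hsymm _ t ht.le, htr _ t ht.le⟩)
    unfold HasLineDerivAt
    simpa only [zero_smul, add_zero] using h
  have hφt : ∀ x t, 0 < t → HasDerivAt (fun s => ftB a b c (Q x s))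
      (-∑ i, ∑ j, Jmap a b c (Q x t) i j * dirD eT (q i j) (x, t)) t := by
    intro x t ht
    refine hasDerivAt_ftB (M := fun s => Q x s) (M' := fun i j => dirD eT (q i j) (x, t))
      (fun i j => hasDerivAt_time (hqs i j) x t) ?_
    filter_upwards [isOpen_Ioi.mem_nhds ht] with s hs using
      ⟨hsymm x s (le_of_lt hs), htr x s (le_of_lt hs)⟩
  have hsub : Set.Ioo 0 t₀ ×ˢ (Set.univ : Set Vec3) ⊆ Set.Iio t₀ ×ˢ Set.univ :=
    Set.prod_mono_left fun t ht => ht.2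
  refine antitoneOn_integral_of_le_divergence
    (F := fun t x => (t₀ - t) * (ftB a b c (Q x t) / (ε * Γ)
      + ∑ i, ∑ j, L1 / Γ / 2 * ∑ k, dirD (eX k) (q i j) (x, t) ^ 2) * Gk Γ L1 x₀ t₀ x t)
    (F' := fun t x => (-(ftB a b c (Q x t) / (ε * Γ)
        + ∑ i, ∑ j, L1 / Γ / 2 * ∑ k, dirD (eX k) (q i j) (x, t) ^ 2)
      + (t₀ - t) * ((-∑ i, ∑ j, Jmap a b c (Q x t) i j * dirD eT (q i j) (x, t)) / (ε * Γ)
        + ∑ i, ∑ j, L1 / Γ / 2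
          * ∑ k, 2 * dirD (eX k) (q i j) (x, t) * dirD eT (dirD (eX k) (q i j)) (x, t)))
        * Gk Γ L1 x₀ t₀ x t
      + (t₀ - t) * (ftB a b c (Q x t) / (ε * Γ)
        + ∑ i, ∑ j, L1 / Γ / 2 * ∑ k, dirD (eX k) (q i j) (x, t) ^ 2)
        * ((3 / (2 * (t₀ - t)) - (∑ i, (x i - x₀ i) ^ 2) / (4 * (L1 / Γ) * (t₀ - t) ^ 2))
          * Gk Γ L1 x₀ t₀ x t))
    (W := fun k t x => ∑ i, ∑ j, Gk Γ L1 x₀ t₀ x t * flux (L1 / Γ) (t₀ - t) x₀ (q i j) k (x, t)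
      + Gk Γ L1 x₀ t₀ x t * ((x k - x₀ k) * ftB a b c (Q x t)) * (1 / (2 * (ε * Γ))))
    (W' := fun k t x => ∑ i, ∑ j,
        (-(x k - x₀ k) / (2 * (L1 / Γ) * (t₀ - t)) * Gk Γ L1 x₀ t₀ x t
            * flux (L1 / Γ) (t₀ - t) x₀ (q i j) k (x, t)
          + Gk Γ L1 x₀ t₀ x t * fluxDeriv (L1 / Γ) (t₀ - t) x₀ (q i j) k (x, t))
      + (-(x k - x₀ k) / (2 * (L1 / Γ) * (t₀ - t)) * Gk Γ L1 x₀ t₀ x t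
          * ((x k - x₀ k) * ftB a b c (Q x t))
        + Gk Γ L1 x₀ t₀ x t * (1 * ftB a b c (Q x t) + (x k - x₀ k)
          * (-∑ i, ∑ j, Jmap a b c (Q x t) i j * dirD (eX k) (q i j) (x, t))))
        * (1 / (2 * (ε * Γ))))
    hK (convex_Ioo 0 t₀) ?_ ?_ ?_ ?_ ?_ ?_ ?_ ?_ ?_
  · simp only [Function.uncurry_def]
    exact ContinuousOn.mul (Continuous.continuousOn (by fun_prop)) (hGct.mono hsub)
  · intro t ht x hx
    simp [hQ x hx t ht.1.le, hA, hD0 _ _ _ x hx t ht.1]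
  · rw [interior_Ioo]
    simp only [Function.uncurry_def]
    have hne : ∀ p ∈ Set.Ioo 0 t₀ ×ˢ (Set.univ : Set Vec3), t₀ - p.1 ≠ 0 := fun p hp =>
      (sub_pos.2 hp.1.2).ne'
    refine ContinuousOn.add (ContinuousOn.mul (Continuous.continuousOn (by fun_prop))
      (hGct.mono hsub)) (ContinuousOn.mul (Continuous.continuousOn (by fun_prop))
      (ContinuousOn.mul (ContinuousOn.sub (ContinuousOn.div (by fun_prop) (by fun_prop) ?_)
        (ContinuousOn.div (by fun_prop) (by fun_prop) ?_)) (hGct.mono hsub)))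
    · exact fun p hp => mul_ne_zero two_ne_zero (hne p hp)
    · exact fun p hp => mul_ne_zero (by positivity) (pow_ne_zero 2 (hne p hp))
  · rw [interior_Ioo]
    intro t ht x
    have hτ : HasDerivAt (fun s => t₀ - s) (-1) t := by
      simpa using (hasDerivAt_id t).const_sub t₀
    have he := HasDerivAt.fun_sum (u := Finset.univ) fun i _ =>
      HasDerivAt.fun_sum (u := Finset.univ) fun j _ =>
        (HasDerivAt.fun_sum (u := Finset.univ) fun k _ =>
          (hasDerivAt_time (contDiff_dirD (hqs i j) (eX k)) x t).fun_pow 2).const_mul (L1 / Γ / 2)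
    refine ((hτ.fun_mul (((hφt x t ht.1).div_const (ε * Γ)).fun_add he)).fun_mul
      (hasDerivAt_Gk hΓ hL1 ht.2 x₀ x)).congr_deriv ?_
    simp
  · intro k t _
    have := hGc t
    have := hφc t
    fun_prop
  · intro k t _
    have := hGc t
    have := hφc t
    have := hJc t
    fun_prop
  · rw [interior_Ioo]
    intro k t ht x
    have hG := hasLineDerivAt_Gk Γ L1 t₀ t x₀ x k
    have h1 := HasDerivAt.fun_sum (u := Finset.univ) fun i _ =>
      HasDerivAt.fun_sum (u := Finset.univ) fun j _ =>
        HasDerivAt.fun_mul hG (hasLineDerivAt_flux (hqs i j) (L1 / Γ) (t₀ - t) x₀ x t k)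
    have h2 := (HasDerivAt.fun_mul hG (HasDerivAt.fun_mul (hasLineDerivAt_coord x₀ x k k)
      (hφx k x t ht.1))).mul_const (1 / (2 * (ε * Γ)))
    refine HasDerivAt.congr_deriv (h1.fun_add h2) ?_
    simp
  · rw [interior_Ioo]
    intro k t ht x hx
    simp [hQ x hx t ht.1.le, hA, hflux0 _ _ _ x hx t ht.1]
  · rw [interior_Ioo]
    intro t ht x
    have hτ : 0 < t₀ - t := sub_pos.2 ht.2
    have hg := Gk_pos hΓ hL1 ht.2 x₀ x
    have hφ := ftB_nonneg ha hb hc (hsymm x t ht.1.le) (htr x t ht.1.le)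
    have hcomp := Finset.sum_le_sum (s := Finset.univ) fun i _ =>
      Finset.sum_le_sum (s := Finset.univ) fun j _ =>
        dirichlet_density_le_divergence (hqs i j) hκ hτ hg.le x₀ (x, t)
          (hsol.dirD_eT i j x ht.1.le)
    exact energy_density_le_divergence hκ hτ hεΓ hg.le hφ (fun k => x k - x₀ k)
      (fun i j => L1 / Γ / 2 * ∑ k, dirD (eX k) (q i j) (x, t) ^ 2)
      (fun i j => L1 / Γ / 2
        * ∑ k, 2 * dirD (eX k) (q i j) (x, t) * dirD eT (dirD (eX k) (q i j)) (x, t))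
      (fun i j => Jmap a b c (Q x t) i j) (fun i j => dirD eT (q i j) (x, t))
      (fun k i j => dirD (eX k) (q i j) (x, t)) _ hcomp

/-- Monotonicity of the weighted energy
`Φ(R) = (R²/Γ) ∫ [(L₁/2)|∇Q|² + f̃_B(Q)/ε](·, t₀−R²) G_{z₀}(·, t₀−R²) dx`:
it is non-decreasing in `R` on `(0, √t₀/2)`. -/
theorem Phi_monotone
    (a b c Γ L1 ε : ℝ) (ha : 0 < a) (hb : 0 < b) (hc : 0 < c)
    (hΓ : 0 < Γ) (hL1 : 0 < L1) (hε : 0 < ε)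
    (Q : Vec3 → ℝ → Mat)
    (hsol : IsSolution a b c Γ L1 ε Q (Set.Ici 0))
    (hconst : ConstOutside a b c Q (Set.Ici 0))
    (h0 : ∀ x : Vec3, Q x 0 ∈ NSet a b c)
    (x₀ : Vec3) (t₀ : ℝ) (ht₀ : 0 < t₀) :
    ∀ R₁ R₂ : ℝ, 0 < R₁ → R₁ ≤ R₂ → R₂ < Real.sqrt t₀ / 2 →
      R₁ ^ 2 / Γ * ∫ x : Vec3,
          (L1 / 2 * gradSq Q x (t₀ - R₁ ^ 2) + ftB a b c (Q x (t₀ - R₁ ^ 2)) / ε)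
            * Gk Γ L1 x₀ t₀ x (t₀ - R₁ ^ 2)
        ≤ R₂ ^ 2 / Γ * ∫ x : Vec3,
            (L1 / 2 * gradSq Q x (t₀ - R₂ ^ 2) + ftB a b c (Q x (t₀ - R₂ ^ 2)) / ε)
              * Gk Γ L1 x₀ t₀ x (t₀ - R₂ ^ 2) := by
  obtain ⟨hsm, -⟩ := id hsol
  obtain ⟨A, hA, K, hK, hQA⟩ := hconst
  obtain ⟨hAs, hAt, hAf⟩ := NSet_properties ha hc hA
  have hsymm : ∀ x t, 0 ≤ t → (Q x t)ᵀ = Q x t := fun x t ht =>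
    hsol.isSymm hb hc hΓ hL1 hε hAs hK hQA (fun y => (NSet_properties ha hc (h0 y)).1) ht
  have htr : ∀ x t, 0 ≤ t → (Q x t).trace = 0 := fun x t ht =>
    hsol.trace_eq_zero hc hΓ hL1 hε hAt hK hQA hsymm
      (fun y => (NSet_properties ha hc (h0 y)).2.1) ht
  have hanti := antitoneOn_weightedEnergy ha hb hc hΓ hL1 hε hsol hK hQA hAf hsymm htr x₀ t₀
  intro R₁ R₂ hR₁ hR hR₂
  have hsq : R₁ ^ 2 ≤ R₂ ^ 2 := by gcongr
  have hR₂t : R₂ ^ 2 < t₀ := by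
    have h1 := Real.sq_sqrt ht₀.le
    nlinarith [Real.sqrt_nonneg t₀]
  have hR₁p : 0 < R₁ ^ 2 := by positivity
  have key := hanti (a := t₀ - R₂ ^ 2) (b := t₀ - R₁ ^ 2) ⟨by linarith, by linarith⟩
    ⟨by linarith, by linarith⟩ (by linarith)
  have hform : ∀ R : ℝ, R ^ 2 / Γ * ∫ x : Vec3,
      (L1 / 2 * gradSq Q x (t₀ - R ^ 2) + ftB a b c (Q x (t₀ - R ^ 2)) / ε)
        * Gk Γ L1 x₀ t₀ x (t₀ - R ^ 2)
      = ∫ x, (t₀ - (t₀ - R ^ 2)) * eDens a b c Γ L1 ε Q x (t₀ - R ^ 2)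
        * Gk Γ L1 x₀ t₀ x (t₀ - R ^ 2) := by
    intro R
    rw [← integral_const_mul]
    refine integral_congr_ae (.of_forall fun x => ?_)
    simp only [eDens]
    field_simp
    ring
  rw [hform, hform]
  exact key
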